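/- arXiv:1909.04463 — 10 statements merged into one kernel-verified Lean document; each statement's English description precedes it below -/
import Mathlib

section
/- Let G = (V, E) be a finite simple graph with at least one edge, with maximum vertex degree Δ ≥ 1, and let φ : V → {1, …, |V|} be any bijection. Then SL_φ(G) ≥ Σ_{k ≥ 0, k·Δ < |E|} (|E| − k·Δ), i.e., the S-labeling value of any labeling is at least the sum, over all nonnegative integers k with k·Δ < |E|, of the quantities |E| − k·Δ. -/
open Finset

/-- The S-labeling value of a labeling `φ` of the vertices of `G`:
the sum over all edges of the minimum of the labels of the two endpoints. -/
def SLabel {V : Type*} [Fintype V] [DecidableEq V] (G : SimpleGraph V)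
    [DecidableRel G.Adj] (φ : V → ℕ) : ℕ :=
  ∑ e ∈ G.edgeFinset, Sym2.lift ⟨fun u v => min (φ u) (φ v), fun _ _ => min_comm _ _⟩ e

/-- The number of vertices carrying a label at most `k` is at most `k`, so at most `k * Δ` edges
have an endpoint with label at most `k`. -/
theorem card_edges_min_label_le {V : Type*} [Fintype V] [DecidableEq V]
    (G : SimpleGraph V) [DecidableRel G.Adj] (φ : V → ℕ) (hinj : Function.Injective φ)
    (hpos : ∀ v, 1 ≤ φ v) (k : ℕ) :
    (G.edgeFinset.filter (fun e => Sym2.lift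
      ⟨fun u v => min (φ u) (φ v), fun _ _ => min_comm _ _⟩ e ≤ k)).card ≤ k * G.maxDegree := by
  have hcard : (Finset.univ.filter (fun v => φ v ≤ k)).card ≤ k := by
    calc (Finset.univ.filter (fun v => φ v ≤ k)).card ≤ (Finset.Icc 1 k).card :=
          Finset.card_le_card_of_injOn φ
            (fun v hv => by simpa using ⟨hpos v, by simpa using hv⟩) hinj.injOn
      _ = k := by simp
  have hsub : G.edgeFinset.filter (fun e => Sym2.lift
      ⟨fun u v => min (φ u) (φ v), fun _ _ => min_comm _ _⟩ e ≤ k) ⊆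
      (Finset.univ.filter (fun v => φ v ≤ k)).biUnion (fun v => G.incidenceFinset v) := by
    intro e
    induction e using Sym2.ind with
    | _ u v =>
      intro he
      simp only [Finset.mem_filter, SimpleGraph.mem_edgeFinset, SimpleGraph.mem_edgeSet,
        Sym2.lift_mk, min_le_iff] at he
      simp only [Finset.mem_biUnion, Finset.mem_filter, Finset.mem_univ, true_and,
        SimpleGraph.mem_incidenceFinset]
      rcases he.2 with h | h
      · exact ⟨u, h, he.1, Sym2.mem_mk_left u v⟩
      · exact ⟨v, h, he.1, Sym2.mem_mk_right u v⟩
  calc _ ≤ _ := Finset.card_le_card hsub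
    _ ≤ (Finset.univ.filter (fun v => φ v ≤ k)).card * G.maxDegree :=
        Finset.card_biUnion_le_card_mul _ _ _ fun v _ => by
          rw [G.card_incidenceFinset_eq_degree]
          exact G.degree_le_maxDegree v
    _ ≤ _ := Nat.mul_le_mul_right _ hcard

/-- Layer-cake lower bound: a sum of natural numbers is at least the sum, over any finite set of
thresholds, of the number of terms exceeding the threshold. -/
theorem sum_card_filter_lt_le_sum {α : Type*} (s : Finset α) (f : α → ℕ) (S : Finset ℕ) :
    ∑ k ∈ S, (s.filter (fun a => k < f a)).card ≤ ∑ a ∈ s, f a := by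
  simp only [Finset.card_filter]
  rw [Finset.sum_comm]
  refine Finset.sum_le_sum fun a _ => ?_
  rw [← Finset.card_filter]
  calc (S.filter (fun k => k < f a)).card ≤ (Finset.range (f a)).card :=
        Finset.card_le_card fun k hk => by simpa using (Finset.mem_filter.mp hk).2
    _ = f a := Finset.card_range _

/-- if `G` has at least one edge and maximum degree `Δ ≥ 1`, then for every
bijective labeling `φ : V → {1, …, |V|}`,
`SL_φ(G) ≥ ∑_{k ≥ 0, k·Δ < |E|} (|E| - k·Δ)`.  (All `k` with `k·Δ < |E|` satisfy
`k < |E|` since `Δ ≥ 1`, so the sum may be taken over `k ∈ range |E|`.) -/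
theorem slabel_ge_sum_lower_bounds {V : Type*} [Fintype V] [DecidableEq V]
    (G : SimpleGraph V) [DecidableRel G.Adj]
    (hE : G.edgeFinset.Nonempty) (hΔ : 1 ≤ G.maxDegree)
    (φ : V → ℕ) (hφ : Set.BijOn φ Set.univ (Set.Icc 1 (Fintype.card V))) :
    ∑ k ∈ (Finset.range G.edgeFinset.card).filter
        (fun k => k * G.maxDegree < G.edgeFinset.card),
      (G.edgeFinset.card - k * G.maxDegree) ≤ SLabel G φ := by
  refine le_trans (Finset.sum_le_sum fun k _ => ?_) (sum_card_filter_lt_le_sum G.edgeFinset _ _)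
  have hsplit := Finset.card_filter_add_card_filter_not (s := G.edgeFinset)
    (fun e => Sym2.lift ⟨fun u v => min (φ u) (φ v), fun _ _ => min_comm _ _⟩ e ≤ k)
  have hle := card_edges_min_label_le G φ (Set.injOn_univ.mp hφ.injOn)
    (fun v => (hφ.mapsTo (Set.mem_univ v)).1) k
  simp only [not_le] at hsplit
  omega
end

section
/- Let G = (V, E) be a finite simple graph with at least one edge whose maximum vertex degree Δ ≥ 1 divides |E|. Then for every bijection φ : V → {1, …, |V|} one has SL_φ(G) ≥ |E|²/(2Δ) + |E|/2. -/
open Finset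

/-- If every fiber of a positive function `f` on `s` has at most `D` elements, then truncating `f`
from below at `k` raises its sum by at most `D * (0 + 1 + ⋯ + (k - 1))`. -/
theorem Finset.sum_max_le_of_card_fiber_le {α : Type*} (s : Finset α) (f : α → ℕ) (D : ℕ)
    (hpos : ∀ a ∈ s, 1 ≤ f a) (hfib : ∀ i, (s.filter (fun a => f a = i)).card ≤ D) (k : ℕ) :
    ∑ a ∈ s, max (f a) k ≤ ∑ a ∈ s, f a + D * ∑ j ∈ range k, j := by
  induction k with
  | zero => simp
  | succ k ih =>
    have hcard : (s.filter (fun a => f a ≤ k)).card ≤ D * k := by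
      have h := Finset.card_le_mul_card_image_of_maps_to (s := s.filter (fun a => f a ≤ k))
        (t := Icc 1 k) (f := f)
        (fun a ha => by
          rw [mem_filter] at ha
          exact mem_Icc.2 ⟨hpos a ha.1, ha.2⟩) D
        (fun i _ => (card_le_card (filter_subset_filter _ (filter_subset _ _))).trans (hfib i))
      simpa using h
    have hstep : ∑ a ∈ s, max (f a) (k + 1) =
        ∑ a ∈ s, max (f a) k + (s.filter (fun a => f a ≤ k)).card := by
      rw [card_filter, ← sum_add_distrib]
      refine sum_congr rfl fun a _ => ?_
      split_ifs <;> omega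
    rw [hstep, sum_range_succ, mul_add]
    omega

/-- The S-labeling weight of an edge is the label of one of its endpoints. -/
theorem exists_mem_edge_eq_min {V : Type*} (φ : V → ℕ) (e : Sym2 V) :
    ∃ v ∈ e, Sym2.lift ⟨fun u v => min (φ u) (φ v), fun _ _ => min_comm _ _⟩ e = φ v := by
  induction e with
  | _ u v =>
    rcases min_choice (φ u) (φ v) with h | h
    · exact ⟨u, Sym2.mem_mk_left u v, h⟩
    · exact ⟨v, Sym2.mem_mk_right u v, h⟩

/-- if `G` has at least one edge and its maximum degree `Δ ≥ 1` divides `|E|`,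
then every bijective labeling `φ : V → {1, …, |V|}` satisfies
`SL_φ(G) ≥ |E|²/(2Δ) + |E|/2`. -/
theorem slabel_ge_of_maxDegree_dvd {V : Type*} [Fintype V] [DecidableEq V]
    (G : SimpleGraph V) [DecidableRel G.Adj]
    (hE : G.edgeFinset.Nonempty) (hΔ : 1 ≤ G.maxDegree)
    (hdvd : G.maxDegree ∣ G.edgeFinset.card)
    (φ : V → ℕ) (hφ : Set.BijOn φ Set.univ (Set.Icc 1 (Fintype.card V))) :
    (G.edgeFinset.card : ℚ) ^ 2 / (2 * G.maxDegree) + (G.edgeFinset.card : ℚ) / 2 ≤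
      (SLabel G φ : ℚ) := by
  obtain ⟨k, hk⟩ := hdvd
  set f : Sym2 V → ℕ := Sym2.lift ⟨fun u v => min (φ u) (φ v), fun _ _ => min_comm _ _⟩ with hf
  have hpos : ∀ e ∈ G.edgeFinset, 1 ≤ f e := fun e _ => by
    obtain ⟨v, -, hv⟩ := exists_mem_edge_eq_min φ e
    rw [hf, hv]
    exact (hφ.mapsTo (Set.mem_univ v)).1
  have hfib : ∀ i, (G.edgeFinset.filter (fun e => f e = i)).card ≤ G.maxDegree := fun i => by
    rcases (G.edgeFinset.filter (fun e => f e = i)).eq_empty_or_nonempty with h | ⟨e₀, he₀⟩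
    · simp [h]
    obtain ⟨w, -, hw⟩ := exists_mem_edge_eq_min φ e₀
    refine le_trans (card_le_card fun e he => ?_)
      ((G.card_incidenceFinset_eq_degree w).le.trans (G.degree_le_maxDegree w))
    rw [mem_filter] at he he₀
    obtain ⟨v, hve, hv⟩ := exists_mem_edge_eq_min φ e
    have hvw : v = w := hφ.injOn (Set.mem_univ v) (Set.mem_univ w)
      (hv.symm.trans (he.2.trans (he₀.2.symm.trans hw)))
    rw [SimpleGraph.mem_incidenceFinset]
    exact ⟨SimpleGraph.mem_edgeFinset.1 he.1, hvw ▸ hve⟩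
  have hmax := Finset.sum_max_le_of_card_fiber_le G.edgeFinset f G.maxDegree hpos hfib k
  have hconst : G.edgeFinset.card * k ≤ ∑ e ∈ G.edgeFinset, max (f e) k := by
    simpa using card_nsmul_le_sum G.edgeFinset (fun e => max (f e) k) k fun e _ => le_max_right _ _
  have hbound : ((G.maxDegree * k * k : ℕ) : ℚ) ≤
      ((SLabel G φ + G.maxDegree * ∑ j ∈ range k, j : ℕ) : ℚ) :=
    Nat.cast_le.2 (hk ▸ hconst.trans hmax)
  have hgauss : (((∑ j ∈ range k, j : ℕ) : ℚ)) = k * (k - 1) / 2 := by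
    clear * -
    induction k with
    | zero => simp
    | succ k ih =>
      rw [sum_range_succ, Nat.cast_add, ih]
      push_cast
      ring
  have hΔ' : (G.maxDegree : ℚ) ≠ 0 := by
    exact_mod_cast Nat.one_le_iff_ne_zero.1 hΔ
  rw [hk]
  rw [Nat.cast_add, Nat.cast_mul G.maxDegree (∑ j ∈ range k, j), hgauss] at hbound
  push_cast at hbound ⊢
  have hsq : ((G.maxDegree : ℚ) * k) ^ 2 / (2 * G.maxDegree) = G.maxDegree * k * k / 2 := by
    field_simp
  rw [hsq]
  linarith
end

section
/- Let G = (V, E) be a finite simple graph, let φ : V → {1, …, |V|} be a bijection, and suppose three vertices i, i', i'' form a triangle in G, with edges e = {i, i'}, e' = {i, i''}, e'' = {i', i''}. For an edge {u,v} ∈ E define its contribution label as min(φ(u), φ(v)). Then for every subset V' ⊆ {1, …, |V|} of labels, the number of edges among e, e', e'' whose contribution label lies in V' is at most 1 plus the number of vertices among i, i', i'' whose label φ lies in V'. (This is the combinatorial content of the TRIANGLE valid inequalities.) -/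
open Finset

/-- combinatorial content of the TRIANGLE valid inequalities:
if `i, i', i''` form a triangle in `G` and `φ : V → {1, …, |V|}` is a bijective labeling,
then for any subset `V'` of the labels, the number of triangle edges whose contribution
label (the minimum of its endpoint labels) lies in `V'` is at most `1` plus the number
of triangle vertices whose label lies in `V'`. -/
theorem triangle_inequality_valid {V : Type*} [Fintype V] [DecidableEq V]
    (G : SimpleGraph V) [DecidableRel G.Adj] (φ : V → ℕ)
    (hφ : Set.BijOn φ Set.univ (Set.Icc 1 (Fintype.card V)))
    (i i' i'' : V) (h1 : G.Adj i i') (h2 : G.Adj i i'') (h3 : G.Adj i' i'')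
    (V' : Finset ℕ) (hV' : V' ⊆ Finset.Icc 1 (Fintype.card V)) :
    ((if min (φ i) (φ i') ∈ V' then 1 else 0) +
     (if min (φ i) (φ i'') ∈ V' then 1 else 0) +
     (if min (φ i') (φ i'') ∈ V' then 1 else 0) : ℕ) ≤
      1 + ((if φ i ∈ V' then 1 else 0) +
           (if φ i' ∈ V' then 1 else 0) +
           (if φ i'' ∈ V' then 1 else 0)) := by
  rcases le_total (φ i) (φ i') with h | h <;>
  rcases le_total (φ i) (φ i'') with h' | h' <;>
  rcases le_total (φ i') (φ i'') with h'' | h'' <;>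
  simp only [h, h', h'', min_eq_left, min_eq_right] <;>
  grind
end

section
/- Let n ≥ 2 and let a, b be integers with 1 ≤ a < b ≤ n. For k ∈ {1, …, n} define f(k) = k − Σ_{l=1}^{k−1} (k − l)·(χ[l = a] + χ[l = b]) ∈ ℤ, where χ[·] is the 0/1 indicator. Then f(k) = k for k ≤ a, f(k) = a for a ≤ k ≤ b, and f(k) = a + b − k < a for k > b; in particular max_{1 ≤ k ≤ n} f(k) = a. (This is the correctness of constraints (F1.2): for an edge whose two endpoint labels are a < b, the largest right-hand side among the constraints θ_e ≥ k − Σ_{l<k}(k−l)(x_i^l + x_{i'}^l) equals min of the two labels, namely a.) -/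
open Finset

/-- Weighting `k - l` by the indicator of `l = c` over `1 ≤ l < k` leaves `max (k - c) 0`. -/
theorem sum_Ico_sub_mul_indicator (k c : ℕ) (hc : 1 ≤ c) :
    ∑ l ∈ Finset.Ico 1 k, ((k : ℤ) - (l : ℤ)) * (if l = c then 1 else 0) =
      max ((k : ℤ) - c) 0 := by
  simp only [mul_ite, mul_one, mul_zero, Finset.sum_ite_eq', Finset.mem_Ico]
  split_ifs <;> omega

/-- correctness of constraints (F1.2): let `n ≥ 2`, `1 ≤ a < b ≤ n`, and for
`k ∈ {1, …, n}` let `f k = k - ∑_{l=1}^{k-1} (k - l)·(χ[l = a] + χ[l = b])`.  Then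
`f k = k` for `k ≤ a`, `f k = a` for `a ≤ k ≤ b`, `f k = a + b - k < a` for `k > b`,
and the maximum of `f` over `{1, …, n}` equals `a`. -/
theorem f1_constraint_rhs_correct (n a b : ℕ) (hn : 2 ≤ n) (ha : 1 ≤ a) (hab : a < b)
    (hb : b ≤ n) (f : ℕ → ℤ)
    (hf : ∀ k, f k = (k : ℤ) - ∑ l ∈ Finset.Ico 1 k,
        ((k : ℤ) - (l : ℤ)) * ((if l = a then 1 else 0) + (if l = b then 1 else 0))) :
    (∀ k, 1 ≤ k → k ≤ a → f k = (k : ℤ)) ∧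
    (∀ k, a ≤ k → k ≤ b → f k = (a : ℤ)) ∧
    (∀ k, b < k → k ≤ n → f k = (a : ℤ) + (b : ℤ) - (k : ℤ) ∧ f k < (a : ℤ)) ∧
    IsGreatest (f '' Set.Icc 1 n) (a : ℤ) := by
  have hf' (k : ℕ) : f k = k - (max ((k : ℤ) - a) 0 + max ((k : ℤ) - b) 0) := by
    rw [hf, ← sum_Ico_sub_mul_indicator k a ha,
      ← sum_Ico_sub_mul_indicator k b (ha.trans hab.le), ← Finset.sum_add_distrib]
    simp only [mul_add]
  refine ⟨fun k _ _ => ?_, fun k _ _ => ?_, fun k _ _ => ?_,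
    ⟨a, ⟨ha, hab.le.trans hb⟩, ?_⟩, ?_⟩
  · rw [hf']; omega
  · rw [hf']; omega
  · rw [hf']; omega
  · rw [hf']; omega
  · rintro _ ⟨k, -, rfl⟩
    rw [hf']; omega
end

section
/- Let m ≥ 2 and let P_m be the path graph on m vertices v_1 — v_2 — ⋯ — v_m. There exists a bijective labeling φ : {v_1, …, v_m} → {1, …, m} with SL_φ(P_m) = (m−1)²/4 + (m−1)/2 if m is odd, and SL_φ(P_m) = m²/4 if m is even; such a labeling is obtained by assigning the smallest labels 1, 2, …, ⌊m/2⌋ to the vertices in even positions v_2, v_4, … along the path and arbitrary remaining labels to the other vertices. -/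
open Finset

instance (m : ℕ) : DecidableRel (SimpleGraph.pathGraph m).Adj :=
  fun _ _ => decidable_of_iff _ SimpleGraph.pathGraph_adj.symm

theorem pathGraph_succ_edgeFinset (n : ℕ) :
    (SimpleGraph.pathGraph (n + 1)).edgeFinset =
      univ.image fun i : Fin n => s(i.castSucc, i.succ) := by
  ext e
  induction e using Sym2.ind with | _ u v =>
  simp only [SimpleGraph.mem_edgeFinset, SimpleGraph.mem_edgeSet, SimpleGraph.pathGraph_adj,
    mem_image, mem_univ, true_and, Sym2.eq_iff, Fin.ext_iff, Fin.val_castSucc, Fin.val_succ]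
  constructor
  · rintro (h | h)
    · exact ⟨⟨u, by omega⟩, Or.inl ⟨rfl, h⟩⟩
    · exact ⟨⟨v, by omega⟩, Or.inr ⟨rfl, h⟩⟩
  · rintro ⟨i, h | h⟩ <;> omega

/-- The S-labeling value of a path is the sum of the minima of consecutive labels. -/
theorem SLabel_pathGraph_succ (n : ℕ) (f : ℕ → ℕ) :
    SLabel (SimpleGraph.pathGraph (n + 1)) (fun i => f i) =
      ∑ i ∈ range n, min (f i) (f (i + 1)) := by
  rw [SLabel, pathGraph_succ_edgeFinset, sum_image, ← Fin.sum_univ_eq_sum_range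
    (fun i => min (f i) (f (i + 1)))]
  · simp
  · intro i _ j _ h
    simp only [Sym2.eq_iff, Fin.ext_iff, Fin.val_castSucc, Fin.val_succ] at h
    ext
    omega

theorem sum_range_two_mul_half_add_one (k : ℕ) :
    ∑ i ∈ range (2 * k), (i / 2 + 1) = k ^ 2 + k := by
  induction k with
  | zero => simp
  | succ k ih =>
    rw [show 2 * (k + 1) = 2 * k + 1 + 1 by ring, sum_range_succ, sum_range_succ, ih,
      show 2 * k / 2 = k by omega, show (2 * k + 1) / 2 = k by omega]
    ring

/-- The labels `1, …, ⌊m/2⌋` go to the odd (zero-based) positions of the path in increasing order,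
and the larger labels go to the even positions in increasing order. -/
def alternatingLabel (m i : ℕ) : ℕ :=
  if i % 2 = 1 then i / 2 + 1 else m / 2 + i / 2 + 1

theorem bijOn_alternatingLabel (m : ℕ) :
    Set.BijOn (fun i : Fin m => alternatingLabel m i) Set.univ (Set.Icc 1 m) := by
  refine ⟨fun i _ => ?_, fun i _ j _ h => ?_, fun a ha => ?_⟩
  · have := i.isLt
    simp only [alternatingLabel, Set.mem_Icc]
    split_ifs <;> omega
  · have := i.isLt
    have := j.isLt
    simp only [alternatingLabel] at h
    ext
    split_ifs at h <;> omega
  · obtain ⟨h₁, h₂⟩ := Set.mem_Icc.1 ha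
    by_cases h : a ≤ m / 2
    · refine ⟨⟨2 * a - 1, by omega⟩, Set.mem_univ _, ?_⟩
      simp only [alternatingLabel]
      split_ifs <;> omega
    · refine ⟨⟨2 * (a - m / 2 - 1), by omega⟩, Set.mem_univ _, ?_⟩
      simp only [alternatingLabel]
      split_ifs <;> omega

theorem min_alternatingLabel {m i : ℕ} (hi : i + 1 < m) :
    min (alternatingLabel m i) (alternatingLabel m (i + 1)) = i / 2 + 1 := by
  simp only [alternatingLabel]
  split_ifs <;> omega

theorem SLabel_pathGraph_alternatingLabel (n : ℕ) :
    SLabel (SimpleGraph.pathGraph (n + 1)) (fun i => alternatingLabel (n + 1) i) =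
      ∑ i ∈ range n, (i / 2 + 1) := by
  rw [SLabel_pathGraph_succ]
  exact sum_congr rfl fun i hi => min_alternatingLabel (by simpa using hi)

/-- for `m ≥ 2` there is a bijective labeling `φ` of the path graph `P_m`
with `SL_φ(P_m) = (m-1)²/4 + (m-1)/2` if `m` is odd and `SL_φ(P_m) = m²/4` if `m` is even. -/
theorem exists_labeling_pathGraph (m : ℕ) (hm : 2 ≤ m) :
    ∃ φ : Fin m → ℕ, Set.BijOn φ Set.univ (Set.Icc 1 m) ∧
      (SLabel (SimpleGraph.pathGraph m) φ : ℚ) =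
        if Odd m then ((m : ℚ) - 1) ^ 2 / 4 + ((m : ℚ) - 1) / 2 else (m : ℚ) ^ 2 / 4 := by
  refine ⟨fun i => alternatingLabel m i, bijOn_alternatingLabel m, ?_⟩
  obtain ⟨n, rfl⟩ : ∃ n, m = n + 1 := ⟨m - 1, by omega⟩
  rw [SLabel_pathGraph_alternatingLabel]
  obtain ⟨k, rfl | rfl⟩ := Nat.even_or_odd' n
  · rw [if_pos (odd_two_mul_add_one k), sum_range_two_mul_half_add_one]
    push_cast
    ring
  · rw [if_neg (by simp [parity_simps]), sum_range_succ, sum_range_two_mul_half_add_one,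
      show 2 * k / 2 = k by omega]
    push_cast
    ring
end

section
/- Let m ≥ 2 and let P_m be the path graph on m vertices. For every bijective labeling φ of the vertices of P_m with {1, …, m}, one has SL_φ(P_m) ≥ (m−1)²/4 + (m−1)/2 if m is odd, and SL_φ(P_m) ≥ m²/4 if m is even. -/
open Finset

theorem slabel_pathGraph_succ (n : ℕ) (φ : Fin (n + 1) → ℕ) :
    SLabel (SimpleGraph.pathGraph (n + 1)) φ = ∑ i : Fin n, min (φ i.castSucc) (φ i.succ) := by
  symm
  refine Finset.sum_bij (fun i _ => s(i.castSucc, i.succ)) ?_ ?_ ?_ ?_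
  · intro i _
    simp [SimpleGraph.pathGraph_adj]
  · intro i _ j _ h
    simp only [Sym2.eq_iff, Fin.ext_iff, Fin.val_castSucc, Fin.val_succ] at h
    exact Fin.ext (by omega)
  · intro e he
    induction e with
    | _ u v =>
      rw [SimpleGraph.mem_edgeFinset, SimpleGraph.mem_edgeSet, SimpleGraph.pathGraph_adj] at he
      obtain h | h := he
      · refine ⟨⟨u, by omega⟩, mem_univ _, ?_⟩
        exact Sym2.eq_iff.2 (Or.inl ⟨Fin.ext rfl, Fin.ext h⟩)
      · refine ⟨⟨v, by omega⟩, mem_univ _, ?_⟩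
        exact Sym2.eq_iff.2 (Or.inr ⟨Fin.ext rfl, Fin.ext h⟩)
  · intro i _
    rfl

theorem two_mul_sum_Icc_min_add_sq (k d : ℕ) :
    2 * ∑ j ∈ Icc 1 (k + d), min j k = k * (k + 1) + 2 * d * k := by
  induction d with
  | zero =>
    have h : ∑ j ∈ Icc 1 k, min j k = ∑ j ∈ Icc 1 k, j :=
      sum_congr rfl fun j hj => min_eq_left (mem_Icc.1 hj).2
    have h' : 2 * ∑ j ∈ Icc 1 k, j = k * (k + 1) := by
      induction k with
      | zero => rfl
      | succ k ih =>
        rw [sum_Icc_succ_top (by omega), mul_add, ih (sum_congr rfl fun j hj =>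
          min_eq_left (mem_Icc.1 hj).2)]
        ring
    rw [add_zero, h, h']
    ring
  | succ d ih =>
    rw [← add_assoc, sum_Icc_succ_top (by omega), mul_add, ih, min_eq_right (by omega)]
    ring

/-- Truncating the labels at any threshold `k ≤ m` gives a lower bound for the labeling value. -/
theorem mul_le_slabel_pathGraph {m : ℕ} (k d : ℕ) (hm : m = k + d) (φ : Fin m → ℕ)
    (hφ : Set.BijOn φ Set.univ (Set.Icc 1 m)) :
    k * d ≤ SLabel (SimpleGraph.pathGraph m) φ := by
  have hsum : ∑ v, min (φ v) k = ∑ j ∈ Icc 1 m, min j k := by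
    refine sum_bij (fun v _ => φ v) ?_ ?_ ?_ fun _ _ => rfl
    · exact fun v _ => mem_Icc.2 (hφ.mapsTo (Set.mem_univ v))
    · exact fun u _ v _ h => hφ.injOn (Set.mem_univ u) (Set.mem_univ v) h
    · intro j hj
      obtain ⟨v, -, hv⟩ := hφ.surjOn (mem_Icc.1 hj)
      exact ⟨v, mem_univ v, hv⟩
  have htwo := two_mul_sum_Icc_min_add_sq k d
  rw [← hm, ← hsum] at htwo
  clear hsum hφ
  obtain _ | n := m
  · obtain rfl : k = 0 := by omega
    simp
  rw [slabel_pathGraph_succ]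
  have hle : ∑ i : Fin n, (min (φ i.castSucc) k + min (φ i.succ) k) ≤
      ∑ i : Fin n, (min (φ i.castSucc) (φ i.succ) + k) :=
    sum_le_sum fun i _ => by omega
  simp only [sum_add_distrib, sum_const, card_univ, Fintype.card_fin, smul_eq_mul] at hle
  have hlast := Fin.sum_univ_castSucc fun v => min (φ v) k
  have hfirst := Fin.sum_univ_succ fun v => min (φ v) k
  have h0 : min (φ 0) k ≤ k := min_le_right _ _
  have h1 : min (φ (Fin.last n)) k ≤ k := min_le_right _ _
  have hnk : k * k + d * k = n * k + k := by rw [← add_mul, ← hm]; ring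
  nlinarith

/-- for `m ≥ 2`, every bijective labeling `φ` of the path graph `P_m`
satisfies `SL_φ(P_m) ≥ (m-1)²/4 + (m-1)/2` if `m` is odd and `SL_φ(P_m) ≥ m²/4`
if `m` is even. -/
theorem slabel_pathGraph_lower_bound (m : ℕ) (hm : 2 ≤ m)
    (φ : Fin m → ℕ) (hφ : Set.BijOn φ Set.univ (Set.Icc 1 m)) :
    (if Odd m then ((m : ℚ) - 1) ^ 2 / 4 + ((m : ℚ) - 1) / 2 else (m : ℚ) ^ 2 / 4) ≤
      (SLabel (SimpleGraph.pathGraph m) φ : ℚ) := by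
  obtain ⟨k, hk | hk⟩ := m.even_or_odd'
  · have h : ((k * k : ℕ) : ℚ) ≤ SLabel (SimpleGraph.pathGraph m) φ :=
      Nat.cast_le.2 (mul_le_slabel_pathGraph k k (by omega) φ hφ)
    have hk' : (m : ℚ) = 2 * k := mod_cast hk
    rw [if_neg (by simp [hk]), hk']
    push_cast at h
    linarith
  · have h : ((k * (k + 1) : ℕ) : ℚ) ≤ SLabel (SimpleGraph.pathGraph m) φ :=
      Nat.cast_le.2 (mul_le_slabel_pathGraph k (k + 1) (by omega) φ hφ)
    have hk' : (m : ℚ) = 2 * k + 1 := mod_cast hk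
    rw [if_pos ⟨k, hk⟩, hk']
    push_cast at h
    linarith
end

section
/- Let n ≥ 3 and let C_n be the cycle graph on n vertices. For every bijective labeling φ of the vertices of C_n with {1, …, n}, one has SL_φ(C_n) ≥ n²/4 + n/2 if n is even, and SL_φ(C_n) ≥ (n+1)²/4 if n is odd. -/
open Finset

theorem mul_card_edgeFinset_le_SLabel_add {V : Type*} [Fintype V] [DecidableEq V]
    (G : SimpleGraph V) [DecidableRel G.Adj] (φ : V → ℕ) (t : ℕ) :
    t * #G.edgeFinset ≤ SLabel G φ + ∑ v, G.degree v * (t - φ v) := by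
  have hdeg : ∑ v, G.degree v * (t - φ v) =
      ∑ e ∈ G.edgeFinset, ∑ v, if v ∈ e then t - φ v else 0 := by
    rw [Finset.sum_comm]
    refine Finset.sum_congr rfl fun v _ => ?_
    rw [← Finset.sum_filter, Finset.sum_const, smul_eq_mul, ← G.incidenceFinset_eq_filter,
      G.card_incidenceFinset_eq_degree]
  rw [hdeg, SLabel, ← Finset.sum_add_distrib, mul_comm, ← smul_eq_mul]
  refine Finset.card_nsmul_le_sum _ _ _ fun e he => ?_
  induction e with | _ a b
  have hab : a ≠ b := by
    rw [SimpleGraph.mem_edgeFinset, SimpleGraph.mem_edgeSet] at he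
    exact he.ne
  have hsum : (t - φ a) + (t - φ b) ≤ ∑ v, if v ∈ s(a, b) then t - φ v else 0 := by
    calc (t - φ a) + (t - φ b) = ∑ v ∈ {a, b}, if v ∈ s(a, b) then t - φ v else 0 := by
          rw [Finset.sum_pair hab]; simp
      _ ≤ _ := Finset.sum_le_sum_of_subset (Finset.subset_univ _)
  rw [Sym2.lift_mk]
  dsimp only
  omega

theorem two_mul_sum_Icc_tsub (t n : ℕ) (h : t ≤ n) :
    2 * ∑ j ∈ Finset.Icc 1 n, (t - j) + t = t ^ 2 := by
  have hsub : ∑ j ∈ Finset.Icc 1 t, (t - j) = ∑ j ∈ Finset.Icc 1 n, (t - j) := by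
    refine Finset.sum_subset (Finset.Icc_subset_Icc_right h) fun j _ hj => ?_
    simp only [Finset.mem_Icc] at *
    omega
  rw [← hsub]
  clear hsub h
  have hcol : ∑ j ∈ Finset.Icc 1 t, (t - j) = ∑ j ∈ Finset.range t, j := by
    refine Finset.sum_bij' (fun j _ => t - j) (fun j _ => t - j) ?_ ?_ ?_ ?_ ?_ <;>
      intro j hj <;> simp only [Finset.mem_Icc, Finset.mem_range] at * <;> omega
  have := Finset.sum_range_id_mul_two t
  rw [hcol, mul_comm, this]
  cases t with
  | zero => rfl
  | succ k => simp; ring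

theorem cycleGraph_mul_le_SLabel_add (n : ℕ) (hn : 3 ≤ n) (φ : Fin n → ℕ)
    (hφ : Set.BijOn φ Set.univ (Set.Icc 1 n)) (t : ℕ) (ht : t ≤ n) :
    t * n + t ≤ SLabel (SimpleGraph.cycleGraph n) φ + t ^ 2 := by
  have hdeg : ∀ v, (SimpleGraph.cycleGraph n).degree v = 2 := by
    obtain ⟨m, rfl⟩ := Nat.exists_eq_add_of_le' hn
    exact fun v => SimpleGraph.cycleGraph_degree_three_le
  have hcard : #(SimpleGraph.cycleGraph n).edgeFinset = n := by
    have := (SimpleGraph.cycleGraph n).sum_degrees_eq_twice_card_edges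
    simp only [hdeg, Finset.sum_const, Finset.card_univ, Fintype.card_fin, smul_eq_mul] at this
    omega
  have hsum : ∑ v, (t - φ v) = ∑ j ∈ Finset.Icc 1 n, (t - j) := by
    refine Finset.sum_bij (fun v _ => φ v) ?_ ?_ ?_ fun _ _ => rfl
    · exact fun v _ => Finset.mem_Icc.2 (hφ.mapsTo (Set.mem_univ v))
    · exact fun v _ w _ h => hφ.injOn (Set.mem_univ v) (Set.mem_univ w) h
    · intro j hj
      obtain ⟨v, -, hv⟩ := hφ.surjOn (Finset.mem_Icc.1 hj)
      exact ⟨v, Finset.mem_univ v, hv⟩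
  have key := mul_card_edgeFinset_le_SLabel_add (SimpleGraph.cycleGraph n) φ t
  simp only [hdeg] at key
  rw [hcard, ← Finset.mul_sum, hsum] at key
  have := two_mul_sum_Icc_tsub t n ht
  omega

/-- for `n ≥ 3`, every bijective labeling `φ` of the cycle graph `C_n`
satisfies `SL_φ(C_n) ≥ n²/4 + n/2` if `n` is even and `SL_φ(C_n) ≥ (n+1)²/4`
if `n` is odd. -/
theorem slabel_cycleGraph_lower_bound (n : ℕ) (hn : 3 ≤ n)
    (φ : Fin n → ℕ) (hφ : Set.BijOn φ Set.univ (Set.Icc 1 n)) :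
    (if Even n then (n : ℚ) ^ 2 / 4 + (n : ℚ) / 2 else ((n : ℚ) + 1) ^ 2 / 4) ≤
      (SLabel (SimpleGraph.cycleGraph n) φ : ℚ) := by
  split_ifs with h
  · obtain ⟨k, rfl⟩ := h
    have key : ((k * (k + k) + k : ℕ) : ℚ) ≤ (_ + k ^ 2 : ℕ) :=
      Nat.cast_le.2 (cycleGraph_mul_le_SLabel_add _ hn φ hφ k (by omega))
    push_cast at key ⊢
    linarith
  · obtain ⟨k, rfl⟩ := Nat.not_even_iff_odd.1 h
    have key : (((k + 1) * (2 * k + 1) + (k + 1) : ℕ) : ℚ) ≤ (_ + (k + 1) ^ 2 : ℕ) :=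
      Nat.cast_le.2 (cycleGraph_mul_le_SLabel_add _ hn φ hφ (k + 1) (by omega))
    push_cast at key ⊢
    linarith
end

section
/- Let n ≥ 3 and let C_n be the cycle graph on n vertices. The S-labeling number of C_n, i.e., the minimum of SL_φ(C_n) over all bijective labelings φ of its vertices with {1, …, n}, equals n²/4 + n/2 if n is even and (n+1)²/4 if n is odd; equivalently, SL_{φ*}(C_n) = ⌊(n+1)²/4⌋. -/
open Finset

/-- The edges of a cycle graph are the pairs of consecutive vertices. -/
lemma SLabel_cycleGraph (m : ℕ) (φ : Fin (m + 3) → ℕ) :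
    SLabel (SimpleGraph.cycleGraph (m + 3)) φ = ∑ i, min (φ i) (φ (i + 1)) := by
  unfold SLabel
  symm
  refine Finset.sum_bij (fun i _ => s(i, i + 1)) ?_ ?_ ?_ ?_
  · intro i _
    rw [SimpleGraph.mem_edgeFinset, SimpleGraph.mem_edgeSet, SimpleGraph.cycleGraph_adj]
    right
    simp
  · intro i _ j _ h
    rcases Sym2.eq_iff.1 h with h | ⟨h₁, h₂⟩
    · exact h.1
    · exfalso
      have h₃ : (1 + 1 : Fin (m + 3)) = 0 := by
        rw [h₁, add_assoc] at h₂
        exact add_eq_left.1 h₂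
      have h₄ := congrArg Fin.val h₃
      simp only [Fin.val_add, Fin.val_one, Fin.val_zero] at h₄
      rw [Nat.mod_eq_of_lt (by omega)] at h₄
      omega
  · intro e he
    induction e with
    | _ u v =>
      rw [SimpleGraph.mem_edgeFinset, SimpleGraph.mem_edgeSet, SimpleGraph.cycleGraph_adj] at he
      rcases he with h | h
      · exact ⟨v, mem_univ _, by rw [← h, add_sub_cancel, Sym2.eq_swap]⟩
      · exact ⟨u, mem_univ _, by rw [← h, add_sub_cancel]⟩
  · intro i _
    rfl

lemma two_mul_sum_range_tsub_succ_le (n T : ℕ) :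
    2 * ∑ x ∈ range n, (T - (x + 1)) ≤ T * (T - 1) := by
  induction n generalizing T with
  | zero => simp
  | succ n ih =>
    rcases T with _ | T
    · simp
    · have h := ih T
      rw [sum_range_succ']
      simp only [Nat.add_sub_add_right, Nat.add_sub_cancel, zero_add] at h ⊢
      rcases T with _ | T
      · simp
      · simp only [Nat.add_sub_cancel] at h ⊢
        nlinarith

/-- A lower bound on the S-labeling value of a cycle for each threshold `T`. -/
lemma mul_le_sum_min_add {m : ℕ} {φ : Fin (m + 3) → ℕ}
    (hφ : Set.BijOn φ Set.univ (Set.Icc 1 (m + 3))) (T : ℕ) :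
    (m + 3) * T ≤ ∑ i, min (φ i) (φ (i + 1)) + T * (T - 1) := by
  have hshift : ∑ i, (T - φ (i + 1)) = ∑ i, (T - φ i) :=
    Equiv.sum_comp (Equiv.addRight (1 : Fin (m + 3))) fun i => T - φ i
  have hlabels : ∑ i, (T - φ i) = ∑ x ∈ range (m + 3), (T - (x + 1)) := by
    rw [range_eq_Ico, sum_Ico_add' (fun x => T - x) 0 (m + 3) 1]
    refine sum_nbij φ ?_ ?_ ?_ fun _ _ => rfl
    · intro i _
      have h := hφ.mapsTo (Set.mem_univ i)
      simp only [Set.mem_Icc] at h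
      simp only [mem_Ico]
      omega
    · simpa using hφ.injOn
    · intro x hx
      have hx' : x ∈ Set.Icc 1 (m + 3) := by
        simp only [coe_Ico, Set.mem_Ico] at hx
        simp only [Set.mem_Icc]
        omega
      simpa using hφ.surjOn hx'
  calc (m + 3) * T = ∑ _i : Fin (m + 3), T := by simp
    _ ≤ ∑ i, (min (φ i) (φ (i + 1)) + ((T - φ i) + (T - φ (i + 1)))) :=
      sum_le_sum fun i _ => by omega
    _ = ∑ i, min (φ i) (φ (i + 1)) + 2 * ∑ x ∈ range (m + 3), (T - (x + 1)) := by
      rw [sum_add_distrib, sum_add_distrib, hshift, hlabels, two_mul]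
    _ ≤ _ := by grw [two_mul_sum_range_tsub_succ_le]

lemma succ_sq_div_four (n : ℕ) :
    (n + 1) ^ 2 / 4 + (n + 1) / 2 * ((n + 1) / 2 - 1) = n * ((n + 1) / 2) := by
  rcases Nat.even_or_odd' n with ⟨k, rfl | rfl⟩
  · have h₁ : (2 * k + 1) / 2 = k := by omega
    have h₂ : (2 * k + 1) ^ 2 / 4 = k * (k + 1) := by
      have : (2 * k + 1) ^ 2 = 4 * (k * (k + 1)) + 1 := by ring
      omega
    rw [h₁, h₂]
    rcases k with _ | k
    · rfl
    · simp only [Nat.add_sub_cancel]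
      ring
  · have h₁ : (2 * k + 1 + 1) / 2 = k + 1 := by omega
    have h₂ : (2 * k + 1 + 1) ^ 2 / 4 = (k + 1) * (k + 1) := by
      have : (2 * k + 1 + 1) ^ 2 = 4 * ((k + 1) * (k + 1)) := by ring
      omega
    rw [h₁, h₂, Nat.add_sub_cancel]
    ring

lemma sum_range_half_succ (n : ℕ) : ∑ i ∈ range n, (i / 2 + 1) = (n + 1) ^ 2 / 4 := by
  induction n with
  | zero => rfl
  | succ n ih =>
    rw [sum_range_succ, ih]
    rcases Nat.even_or_odd' n with ⟨k, rfl | rfl⟩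
    · ring_nf
      omega
    · ring_nf
      omega

/-- The labeling that puts the labels `1, 2, …` on the vertices `1, 3, …` and the labels
`n, n - 1, …` on the vertices `0, 2, …`. -/
def alternatingLabeling (n i : ℕ) : ℕ :=
  if i % 2 = 1 then (i + 1) / 2 else n - i / 2

lemma bijOn_alternatingLabeling (n : ℕ) :
    Set.BijOn (fun i : Fin n => alternatingLabeling n i) Set.univ (Set.Icc 1 n) := by
  unfold alternatingLabeling
  refine ⟨?_, ?_, ?_⟩
  · intro i _
    have := i.isLt
    simp only [Set.mem_Icc]
    split_ifs <;> omega
  · intro i _ j _ h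
    have := i.isLt
    have := j.isLt
    apply Fin.ext
    simp only at h
    split_ifs at h <;> omega
  · intro x hx
    simp only [Set.mem_Icc] at hx
    by_cases h : x ≤ n / 2
    · refine ⟨⟨2 * x - 1, by omega⟩, Set.mem_univ _, ?_⟩
      simp only
      split_ifs <;> omega
    · refine ⟨⟨2 * (n - x), by omega⟩, Set.mem_univ _, ?_⟩
      simp only
      split_ifs <;> omega

lemma min_alternatingLabeling (m : ℕ) (i : Fin (m + 3)) :
    min (alternatingLabeling (m + 3) i) (alternatingLabeling (m + 3) (i + 1 : Fin (m + 3))) =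
      i / 2 + 1 := by
  have hi := i.isLt
  have hlast : i = Fin.last (m + 2) ↔ (i : ℕ) = m + 2 := by simp [Fin.ext_iff]
  have hsucc := Fin.val_add_one i
  unfold alternatingLabeling
  by_cases h : i = Fin.last (m + 2)
  · rw [if_pos h] at hsucc
    rw [hlast] at h
    rw [hsucc, if_neg (show ¬0 % 2 = 1 by decide)]
    split_ifs <;> omega
  · rw [if_neg h] at hsucc
    rw [hlast] at h
    rw [hsucc]
    split_ifs <;> omega

/-- for `n ≥ 3`, the S-labeling number of the cycle graph `C_n`, i.e. the
minimum of `SL_φ(C_n)` over all bijective labelings `φ`, equals `n²/4 + n/2` if `n` is even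
and `(n+1)²/4` if `n` is odd; equivalently it equals `⌊(n+1)²/4⌋ = (n+1)²/4`
(natural-number division). -/
theorem slabel_number_cycleGraph (n : ℕ) (hn : 3 ≤ n) :
    IsLeast {z : ℕ | ∃ φ : Fin n → ℕ, Set.BijOn φ Set.univ (Set.Icc 1 n) ∧
        SLabel (SimpleGraph.cycleGraph n) φ = z} ((n + 1) ^ 2 / 4) ∧
      (((n + 1) ^ 2 / 4 : ℕ) : ℚ) =
        if Even n then (n : ℚ) ^ 2 / 4 + (n : ℚ) / 2 else ((n : ℚ) + 1) ^ 2 / 4 := by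
  constructor
  · obtain ⟨m, rfl⟩ : ∃ m, n = m + 3 := ⟨n - 3, by omega⟩
    constructor
    · refine ⟨_, bijOn_alternatingLabeling (m + 3), ?_⟩
      rw [SLabel_cycleGraph, sum_congr rfl fun i _ => min_alternatingLabeling m i,
        Fin.sum_univ_eq_sum_range (fun i => i / 2 + 1), sum_range_half_succ]
    · rintro _ ⟨φ, hφ, rfl⟩
      rw [SLabel_cycleGraph]
      have h := mul_le_sum_min_add hφ ((m + 3 + 1) / 2)
      rw [← succ_sq_div_four] at h
      exact Nat.le_of_add_le_add_right h
  · rcases Nat.even_or_odd' n with ⟨k, rfl | rfl⟩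
    · have h : (2 * k + 1) ^ 2 / 4 = k * (k + 1) := by
        have : (2 * k + 1) ^ 2 = 4 * (k * (k + 1)) + 1 := by ring
        omega
      rw [if_pos (even_two_mul k), h]
      push_cast
      ring
    · have h : (2 * k + 1 + 1) ^ 2 / 4 = (k + 1) * (k + 1) := by
        have : (2 * k + 1 + 1) ^ 2 = 4 * ((k + 1) * (k + 1)) := by ring
        omega
      rw [if_neg (by simp), h]
      push_cast
      ring
end

section
/- Let n ≥ 2 and d ≥ 1 with d odd, and let G = (V, E) be a perfect n-ary tree of depth d. For every bijective labeling φ of V with {1, …, |V|}, one has SL_φ(G) ≥ (|V| − 1)²/(2(n+1)) + (|V| − 1)/2. -/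
open Finset

/-- `G` is a perfect `n`-ary tree of depth `d` with root `r`: it is a connected acyclic
graph, every vertex is at distance at most `d` from `r`, the root has degree `n`,
every internal non-root vertex has degree `n + 1`, and every vertex at distance `d`
from `r` has degree `1`. -/
def IsPerfectNaryTree {V : Type*} [Fintype V] [DecidableEq V] (G : SimpleGraph V)
    [DecidableRel G.Adj] (n d : ℕ) (r : V) : Prop :=
  G.Connected ∧ G.IsAcyclic ∧ (∀ v, G.dist r v ≤ d) ∧ G.degree r = n ∧
    (∀ v, 0 < G.dist r v → G.dist r v < d → G.degree v = n + 1) ∧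
    (∀ v, G.dist r v = d → G.degree v = 1)

/-- If each value `j ≥ 1` is taken `c j ≤ N` times, the weighted sum of the values is at least
what one gets by taking the smallest values as often as possible. -/
theorem sq_sum_add_le_weighted_sum (c : ℕ → ℕ) (N : ℕ) (hc : ∀ j, c j ≤ N) (h0 : c 0 = 0)
    (K : ℕ) :
    (∑ j ∈ Finset.range (K + 1), c j) ^ 2 + N * ∑ j ∈ Finset.range (K + 1), c j ≤
      2 * N * ∑ j ∈ Finset.range (K + 1), c j * j := by
  have hS : ∀ K, ∑ j ∈ Finset.range (K + 1), c j ≤ N * K := by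
    intro K
    induction K with
    | zero => simp [h0]
    | succ K ih =>
      rw [Finset.sum_range_succ]
      linarith [hc (K + 1)]
  induction K with
  | zero => simp [h0]
  | succ K ih =>
    rw [Finset.sum_range_succ, Finset.sum_range_succ (fun j => c j * j)]
    have h1 := Nat.mul_le_mul_left (c (K + 1)) (hS K)
    have h2 := Nat.mul_le_mul_left (c (K + 1)) (hc (K + 1))
    nlinarith

/-- The label that an edge contributes to the S-labeling value. -/
def edgeMin {V : Type*} (φ : V → ℕ) : Sym2 V → ℕ :=
  Sym2.lift ⟨fun u v => min (φ u) (φ v), fun _ _ => min_comm _ _⟩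

theorem exists_mem_edgeMin_eq {V : Type*} (φ : V → ℕ) (e : Sym2 V) :
    ∃ v ∈ e, φ v = edgeMin φ e := by
  induction e with
  | h x y =>
    rcases le_total (φ x) (φ y) with h | h
    · exact ⟨x, by simp, by simp [edgeMin, h]⟩
    · exact ⟨y, by simp, by simp [edgeMin, h]⟩

/-- An injective labeling has at most `N` edges with any given minimal label if all degrees are at
most `N`. -/
theorem card_filter_edgeMin_eq_le {V : Type*} [Fintype V] [DecidableEq V] (G : SimpleGraph V)
    [DecidableRel G.Adj] (φ : V → ℕ) (hφ : Function.Injective φ) (N : ℕ)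
    (hdeg : ∀ v, G.degree v ≤ N) (j : ℕ) :
    #{e ∈ G.edgeFinset | edgeMin φ e = j} ≤ N := by
  by_cases hj : ∃ v, φ v = j
  · obtain ⟨v, rfl⟩ := hj
    refine le_trans ?_ (hdeg v)
    rw [← G.card_incidenceFinset_eq_degree v]
    refine Finset.card_le_card fun e he => ?_
    obtain ⟨heG, hev⟩ := Finset.mem_filter.1 he
    obtain ⟨w, hw, hwe⟩ := exists_mem_edgeMin_eq φ e
    obtain rfl : w = v := hφ (hwe.trans hev)
    rw [SimpleGraph.mem_incidenceFinset]
    exact ⟨SimpleGraph.mem_edgeFinset.1 heG, hw⟩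
  · rw [Finset.card_eq_zero.2]
    · exact N.zero_le
    · refine Finset.filter_eq_empty_iff.2 fun e _ he => hj ?_
      obtain ⟨w, -, hwe⟩ := exists_mem_edgeMin_eq φ e
      exact ⟨w, hwe.trans he⟩

/-- The S-labeling value of a positive injective labeling of a graph of maximum degree at most `N`
is bounded below in terms of the number of edges. -/
theorem sq_card_edgeFinset_add_le_SLabel {V : Type*} [Fintype V] [DecidableEq V]
    (G : SimpleGraph V) [DecidableRel G.Adj] (φ : V → ℕ) (hφ : Function.Injective φ)
    (hpos : ∀ v, 0 < φ v) (N : ℕ) (hdeg : ∀ v, G.degree v ≤ N) :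
    #G.edgeFinset ^ 2 + N * #G.edgeFinset ≤ 2 * N * SLabel G φ := by
  set K := G.edgeFinset.sup (edgeMin φ)
  have hK : ∀ e ∈ G.edgeFinset, edgeMin φ e ∈ Finset.range (K + 1) := fun e he =>
    Finset.mem_range_succ_iff.2 (Finset.le_sup he)
  have hS : SLabel G φ =
      ∑ j ∈ Finset.range (K + 1), #{e ∈ G.edgeFinset | edgeMin φ e = j} * j := by
    change ∑ e ∈ G.edgeFinset, edgeMin φ e = _
    rw [← Finset.sum_fiberwise_of_maps_to hK]
    refine Finset.sum_congr rfl fun j _ => ?_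
    exact Finset.sum_const_nat fun e he => (Finset.mem_filter.1 he).2
  rw [hS, Finset.card_eq_sum_card_fiberwise hK]
  refine sq_sum_add_le_weighted_sum _ N (card_filter_edgeMin_eq_le G φ hφ N hdeg) ?_ K
  rw [Finset.card_eq_zero]
  refine Finset.filter_eq_empty_iff.2 fun e _ he => ?_
  obtain ⟨w, -, hwe⟩ := exists_mem_edgeMin_eq φ e
  exact (hpos w).ne' (hwe.trans he)

theorem IsPerfectNaryTree.degree_le {V : Type*} [Fintype V] [DecidableEq V] {G : SimpleGraph V}
    [DecidableRel G.Adj] {n d : ℕ} {r : V} (hG : IsPerfectNaryTree G n d r) (v : V) :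
    G.degree v ≤ n + 1 := by
  obtain ⟨hconn, -, hdist, hroot, hint, hleaf⟩ := hG
  rcases (hdist v).lt_or_eq with h | h
  · rcases (G.dist r v).eq_zero_or_pos with h0 | h0
    · obtain rfl : r = v := hconn.dist_eq_zero_iff.1 h0
      omega
    · exact (hint v h0 h).le
  · have := hleaf v h
    omega

/-- for `n ≥ 2` and odd `d ≥ 1`, every bijective labeling `φ` of a perfect
`n`-ary tree `G` of depth `d` satisfies `SL_φ(G) ≥ (|V| - 1)²/(2(n+1)) + (|V| - 1)/2`. -/
theorem slabel_perfect_nary_tree_odd_lower_bound {V : Type*} [Fintype V] [DecidableEq V]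
    (G : SimpleGraph V) [DecidableRel G.Adj] (n d : ℕ) (r : V)
    (hn : 2 ≤ n) (hd : 1 ≤ d) (hodd : Odd d)
    (hG : IsPerfectNaryTree G n d r)
    (hcard : Fintype.card V = (n ^ (d + 1) - 1) / (n - 1))
    (φ : V → ℕ) (hφ : Set.BijOn φ Set.univ (Set.Icc 1 (Fintype.card V))) :
    ((Fintype.card V : ℚ) - 1) ^ 2 / (2 * ((n : ℚ) + 1)) +
        ((Fintype.card V : ℚ) - 1) / 2 ≤ (SLabel G φ : ℚ) := by
  have htree : G.IsTree := ⟨hG.1, hG.2.1⟩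
  have hE : (#G.edgeFinset : ℚ) = (Fintype.card V : ℚ) - 1 := by
    rw [← htree.card_edgeFinset]
    push_cast
    ring
  have key := sq_card_edgeFinset_add_le_SLabel G φ (Set.injOn_univ.1 hφ.injOn)
    (fun v => (hφ.mapsTo (Set.mem_univ v)).1) (n + 1) hG.degree_le
  rw [← hE]
  have key' : (#G.edgeFinset : ℚ) ^ 2 + ((n : ℚ) + 1) * #G.edgeFinset ≤
      2 * ((n : ℚ) + 1) * SLabel G φ := by exact_mod_cast key
  have hn0 : (0 : ℚ) < 2 * ((n : ℚ) + 1) := by positivity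
  calc (#G.edgeFinset : ℚ) ^ 2 / (2 * ((n : ℚ) + 1)) + (#G.edgeFinset : ℚ) / 2
      = ((#G.edgeFinset : ℚ) ^ 2 + ((n : ℚ) + 1) * #G.edgeFinset) / (2 * ((n : ℚ) + 1)) := by
        field_simp
    _ ≤ (SLabel G φ : ℚ) := by
        rw [div_le_iff₀ hn0]
        linarith
end

section
/- Let G be the 3 × 3 grid graph, whose unique vertex of maximum degree is the center vertex (of degree 4). There exists a bijective labeling φ of its vertices with {1, …, 9} that is optimal, i.e., SL_φ(G) = 30 = SL_{φ*}(G), and in which the vertex receiving label 1 is not a vertex of maximum degree (it has degree 3, while the maximum degree of G is 4). In particular, it is not true that in every optimal labeling the vertex with label 1 has maximum degree. -/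
open Finset SimpleGraph

/-- The 3 × 3 grid graph: the box (Cartesian) product of the path graph on 3 vertices
with itself. -/
def gridGraph33 : SimpleGraph (Fin 3 × Fin 3) :=
  SimpleGraph.pathGraph 3 □ SimpleGraph.pathGraph 3

instance : DecidableRel gridGraph33.Adj :=
  fun _ _ => decidable_of_iff _ (SimpleGraph.boxProd_adj).symm

theorem SLabel_mono {V : Type*} [Fintype V] [DecidableEq V] (G : SimpleGraph V)
    [DecidableRel G.Adj] {φ ψ : V → ℕ} (h : φ ≤ ψ) : SLabel G φ ≤ SLabel G ψ := by
  refine Finset.sum_le_sum fun e _ => ?_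
  induction e using Sym2.ind with
  | _ u v => exact min_le_min (h u) (h v)

theorem edgeFinset_gridGraph33 : gridGraph33.edgeFinset =
    {s((0, 0), (0, 1)), s((0, 1), (0, 2)), s((1, 0), (1, 1)), s((1, 1), (1, 2)),
     s((2, 0), (2, 1)), s((2, 1), (2, 2)), s((0, 0), (1, 0)), s((0, 1), (1, 1)),
     s((0, 2), (1, 2)), s((1, 0), (2, 0)), s((1, 1), (2, 1)), s((1, 2), (2, 2))} := by
  decide +kernel

theorem SLabel_gridGraph33 (φ : Fin 3 × Fin 3 → ℕ) : SLabel gridGraph33 φ =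
    min (φ (0, 0)) (φ (0, 1)) + min (φ (0, 1)) (φ (0, 2)) +
    min (φ (1, 0)) (φ (1, 1)) + min (φ (1, 1)) (φ (1, 2)) +
    min (φ (2, 0)) (φ (2, 1)) + min (φ (2, 1)) (φ (2, 2)) +
    min (φ (0, 0)) (φ (1, 0)) + min (φ (0, 1)) (φ (1, 1)) +
    min (φ (0, 2)) (φ (1, 2)) + min (φ (1, 0)) (φ (2, 0)) +
    min (φ (1, 1)) (φ (2, 1)) + min (φ (1, 2)) (φ (2, 2)) := by
  rw [SLabel, edgeFinset_gridGraph33]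
  repeat rw [Finset.sum_insert (by decide)]
  simp only [Finset.sum_singleton, Sym2.lift_mk]
  ring

/-- The labeling with labels `1`, `2`, `3` on `a`, `b`, `c` and `4` on all other vertices. It bounds
from below every injective positive labeling with the labels `1`, `2`, `3` on `a`, `b`, `c`. -/
def truncatedLabeling {V : Type*} [DecidableEq V] (a b c : V) (v : V) : ℕ :=
  if v = a then 1 else if v = b then 2 else if v = c then 3 else 4

theorem thirty_le_SLabel_truncatedLabeling :
    ∀ a b c : Fin 3 × Fin 3, 30 ≤ SLabel gridGraph33 (truncatedLabeling a b c) := by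
  simp only [SLabel_gridGraph33]
  decide +kernel

theorem thirty_le_SLabel_gridGraph33 {ψ : Fin 3 × Fin 3 → ℕ}
    (hψ : Set.BijOn ψ Set.univ (Set.Icc 1 9)) : 30 ≤ SLabel gridGraph33 ψ := by
  obtain ⟨a, -, ha⟩ := hψ.surjOn (show 1 ∈ Set.Icc 1 9 by simp)
  obtain ⟨b, -, hb⟩ := hψ.surjOn (show 2 ∈ Set.Icc 1 9 by simp)
  obtain ⟨c, -, hc⟩ := hψ.surjOn (show 3 ∈ Set.Icc 1 9 by simp)
  refine (thirty_le_SLabel_truncatedLabeling a b c).trans (SLabel_mono _ fun v => ?_)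
  have hv := (hψ.mapsTo (Set.mem_univ v)).1
  have hinj : ∀ w, ψ v = ψ w → v = w :=
    fun w => hψ.injOn (Set.mem_univ v) (Set.mem_univ w)
  have := hinj a
  have := hinj b
  have := hinj c
  unfold truncatedLabeling
  split_ifs <;> grind

/-- The labeling with labels `1`, `2`, `3`, `4` on the four neighbors of the center. -/
def sideMidpointLabeling (v : Fin 3 × Fin 3) : ℕ :=
  ![![5, 1, 6], ![2, 7, 3], ![8, 4, 9]] v.1 v.2

theorem bijOn_sideMidpointLabeling :
    Set.BijOn sideMidpointLabeling Set.univ (Set.Icc 1 9) := by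
  have h : Finset.univ.image sideMidpointLabeling = Finset.Icc 1 9 := by decide +kernel
  refine Set.BijOn.mk (fun v _ => ?_) (Function.Injective.injOn ?_) fun n hn => ?_
  · rw [← Finset.coe_Icc, ← h]
    simp
  · unfold Function.Injective
    decide +kernel
  · rw [← Finset.coe_Icc, ← h] at hn
    simpa using hn

/-- the maximum degree of the 3 × 3 grid graph is `4` (attained only by the
center), yet there exists an optimal bijective labeling `φ` (i.e. `SL_φ = 30`, the
S-labeling number, so that every bijective labeling `ψ` has `SL_ψ ≥ 30`) in which the
vertex receiving label `1` has degree `3`, not the maximum degree `4`.  In particular it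
is not true that in every optimal labeling the vertex with label `1` has maximum
degree. -/
theorem exists_optimal_labeling_gridGraph33_label_one_not_maxDegree :
    gridGraph33.maxDegree = 4 ∧
    ∃ φ : Fin 3 × Fin 3 → ℕ, Set.BijOn φ Set.univ (Set.Icc 1 9) ∧
      SLabel gridGraph33 φ = 30 ∧
      (∀ ψ : Fin 3 × Fin 3 → ℕ, Set.BijOn ψ Set.univ (Set.Icc 1 9) →
        30 ≤ SLabel gridGraph33 ψ) ∧
      ∀ v : Fin 3 × Fin 3, φ v = 1 →
        gridGraph33.degree v = 3 ∧ gridGraph33.degree v ≠ gridGraph33.maxDegree := by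
  have hmax : gridGraph33.maxDegree = 4 := by decide +kernel
  refine ⟨hmax, sideMidpointLabeling, bijOn_sideMidpointLabeling,
    by rw [SLabel_gridGraph33]; decide +kernel,
    fun _ => thirty_le_SLabel_gridGraph33, ?_⟩
  have hdeg : ∀ v, sideMidpointLabeling v = 1 → gridGraph33.degree v = 3 := by decide +kernel
  intro v hv
  rw [hmax, hdeg v hv]
  decide
end
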